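/- Let p be a prime and (M_λ)_{λ∈Λ} a family of abelian groups such that each M_λ is p-adically complete and such that their p^∞-torsion is uniformly bounded: there exists n₀ with M_λ[p^∞] = M_λ[p^{n₀}] for all λ ∈ Λ. Then the natural map from the p-adic completion of the direct sum ⊕_{λ∈Λ} M_λ to the product ∏_{λ∈Λ} M_λ (induced by completing each projection, using that each M_λ is complete) is injective, and its image equals the set of families (m_λ) ∈ ∏_λ M_λ such that for every N ≥ 0 the set {λ ∈ Λ : m_λ ∉ p^N M_λ} is finite. -/

import Mathlib

open DirectSum

open AdicCompletion in
/-- The natural map from the `I`-adic completion of a direct sum of `I`-adically complete modules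
to their product. -/
noncomputable def adicCompletionDirectSumToPi {R : Type*} [CommRing R] (I : Ideal R) {ι : Type*}
    (M : ι → Type*) [∀ i, AddCommGroup (M i)] [∀ i, Module R (M i)]
    [∀ i, IsAdicComplete I (M i)] :
    AdicCompletion I (⨁ i, M i) →ₗ[R] (∀ i, M i) :=
  LinearMap.pi fun i => (ofLinearEquiv I (M i)).symm.toLinearMap ∘ₗ
    (AdicCompletion.map I (DirectSum.component R ι M i)).restrictScalars R

theorem adicCompletionDirectSumToPi_of {R : Type*} [CommRing R] (I : Ideal R) {ι : Type*}
    (M : ι → Type*) [∀ i, AddCommGroup (M i)] [∀ i, Module R (M i)]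
    [∀ i, IsAdicComplete I (M i)] (x : ⨁ i, M i) :
    adicCompletionDirectSumToPi I M (AdicCompletion.of I _ x) = fun i => x i := by
  funext i
  simp only [adicCompletionDirectSumToPi, LinearMap.pi_apply, LinearMap.comp_apply,
    LinearMap.restrictScalars_apply, AdicCompletion.map_of, LinearEquiv.coe_coe,
    AdicCompletion.ofLinearEquiv_symm_of]
  rfl

theorem adicCompletionDirectSumToPi_sub_mem {R : Type*} [CommRing R] (I : Ideal R) {ι : Type*}
    (M : ι → Type*) [∀ i, AddCommGroup (M i)] [∀ i, Module R (M i)]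
    [∀ i, IsAdicComplete I (M i)] {ξ : AdicCompletion I (⨁ i, M i)} {n : ℕ} {x : ⨁ i, M i}
    (h : AdicCompletion.eval I _ n ξ = Submodule.Quotient.mk x) (i : ι) :
    adicCompletionDirectSumToPi I M ξ i - x i ∈ (I ^ n • ⊤ : Submodule R (M i)) := by
  have key : AdicCompletion.of I (M i) (adicCompletionDirectSumToPi I M ξ i) =
      AdicCompletion.map I (DirectSum.component R ι M i) ξ :=
    AdicCompletion.of_ofLinearEquiv_symm I _
  have := congrArg (AdicCompletion.eval I (M i) n) key
  rw [AdicCompletion.eval_of, AdicCompletion.eval_apply, AdicCompletion.map_val_apply,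
    ← AdicCompletion.eval_apply, h] at this
  exact (Submodule.Quotient.eq _).mp this

theorem Submodule.mem_span_singleton_pow_smul_top_iff {R M : Type*} [CommRing R] [AddCommGroup M]
    [Module R M] (r : R) (n : ℕ) (x : M) :
    x ∈ (Ideal.span {r} ^ n • ⊤ : Submodule R M) ↔ ∃ y : M, x = r ^ n • y := by
  rw [Ideal.span_singleton_pow, Submodule.ideal_span_singleton_smul,
    Submodule.mem_smul_pointwise_iff_exists]
  simp [eq_comm]

theorem DirectSum.mem_span_singleton_pow_smul_top_iff {R : Type*} [CommRing R] {ι : Type*}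
    {M : ι → Type*} [∀ i, AddCommGroup (M i)] [∀ i, Module R (M i)] (r : R) (n : ℕ)
    (x : ⨁ i, M i) :
    x ∈ (Ideal.span {r} ^ n • ⊤ : Submodule R (⨁ i, M i)) ↔
      ∀ i, x i ∈ (Ideal.span {r} ^ n • ⊤ : Submodule R (M i)) := by
  classical
  simp only [Submodule.mem_span_singleton_pow_smul_top_iff]
  constructor
  · rintro ⟨y, rfl⟩ i
    exact ⟨y i, rfl⟩
  · intro h
    choose y hy using h
    refine ⟨DirectSum.mk M (DFinsupp.support x) fun i => y i, ?_⟩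
    ext i
    rw [DirectSum.smul_apply]
    by_cases hi : i ∈ DFinsupp.support x
    · rw [DirectSum.mk_apply_of_mem hi, ← hy]
    · rw [DirectSum.mk_apply_of_notMem hi, smul_zero]
      exact DFinsupp.notMem_support_iff.mp hi

theorem adicCompletionDirectSumToPi_injective {R : Type*} [CommRing R] (r : R) {ι : Type*}
    (M : ι → Type*) [∀ i, AddCommGroup (M i)] [∀ i, Module R (M i)]
    [∀ i, IsAdicComplete (Ideal.span {r}) (M i)] :
    Function.Injective (adicCompletionDirectSumToPi (Ideal.span {r}) M) := by
  rw [injective_iff_map_eq_zero]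
  intro ξ hξ
  refine AdicCompletion.ext fun n => ?_
  obtain ⟨x, hx⟩ := Submodule.Quotient.mk_surjective _ (AdicCompletion.eval _ _ n ξ)
  rw [AdicCompletion.val_zero_apply, ← AdicCompletion.eval_apply, ← hx,
    Submodule.Quotient.mk_eq_zero, DirectSum.mem_span_singleton_pow_smul_top_iff]
  intro i
  have h := adicCompletionDirectSumToPi_sub_mem _ M hx.symm i
  rw [hξ, Pi.zero_apply, zero_sub] at h
  exact neg_mem_iff.mp h

theorem range_adicCompletionDirectSumToPi {R : Type*} [CommRing R] (r : R) {ι : Type*}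
    (M : ι → Type*) [∀ i, AddCommGroup (M i)] [∀ i, Module R (M i)]
    [∀ i, IsAdicComplete (Ideal.span {r}) (M i)] :
    Set.range (adicCompletionDirectSumToPi (Ideal.span {r}) M) =
      {m | ∀ n : ℕ, {i | m i ∉ (Ideal.span {r} ^ n • ⊤ : Submodule R (M i))}.Finite} := by
  classical
  ext m
  constructor
  · rintro ⟨ξ, rfl⟩ n
    obtain ⟨x, hx⟩ := Submodule.Quotient.mk_surjective _ (AdicCompletion.eval _ _ n ξ)
    refine (DFinsupp.support x).finite_toSet.subset fun i hi => ?_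
    by_contra h
    have hxi : x i = 0 := DFinsupp.notMem_support_iff.mp h
    have := adicCompletionDirectSumToPi_sub_mem _ M hx.symm i
    rw [hxi, sub_zero] at this
    exact hi this
  · intro hm
    let x (n : ℕ) : ⨁ i, M i := DirectSum.mk M (hm n).toFinset fun i => m i
    have hx (n : ℕ) (i : ι) :
        m i - x n i ∈ (Ideal.span {r} ^ n • ⊤ : Submodule R (M i)) := by
      by_cases hi : i ∈ (hm n).toFinset
      · simp only [x, DirectSum.mk_apply_of_mem hi, sub_self, zero_mem]
      · simp only [x, DirectSum.mk_apply_of_notMem hi, sub_zero]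
        simpa using hi
    let a : AdicCompletion.AdicCauchySequence (Ideal.span {r}) (⨁ i, M i) :=
      AdicCompletion.AdicCauchySequence.mk _ _ x fun n => by
        rw [SModEq.sub_mem, DirectSum.mem_span_singleton_pow_smul_top_iff]
        intro i
        have h := sub_mem
          (Submodule.smul_mono_left (Ideal.pow_le_pow_right n.le_succ) (hx (n + 1) i)) (hx n i)
        rwa [sub_sub_sub_cancel_left] at h
    refine ⟨AdicCompletion.mk _ _ a, funext fun i => ?_⟩
    rw [IsHausdorff.eq_iff_smodEq (I := Ideal.span {r})]
    intro n
    rw [SModEq.sub_mem]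
    have h : AdicCompletion.eval _ _ n (AdicCompletion.mk _ _ a) =
      Submodule.Quotient.mk (x n) := rfl
    have := sub_mem (adicCompletionDirectSumToPi_sub_mem _ M h i) (hx n i)
    rwa [sub_sub_sub_cancel_right] at this

/-- Let `(M_λ)_{λ ∈ Λ}` be a family of `p`-adically complete abelian
groups with uniformly bounded `p^∞`-torsion (`M_λ[p^∞] = M_λ[p^{n₀}]` for all `λ`).
Then the natural map from the `p`-adic completion of `⊕_λ M_λ` to `∏_λ M_λ`
(characterized by: it extends the inclusion `⊕ M_λ → ∏ M_λ` and is compatible with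
the `p`-adic filtration of the completion) is injective, with image the set of
families `(m_λ)` such that for every `N` only finitely many `m_λ` lie outside
`p^N M_λ`. -/
theorem completion_of_direct_sum_into_product
    (p : ℕ) (hp : p.Prime) (Λ : Type*) [DecidableEq Λ] (M : Λ → Type*)
    [∀ l, AddCommGroup (M l)]
    [∀ l, IsAdicComplete (Ideal.span {(p : ℤ)}) (M l)]
    (n₀ : ℕ)
    (hbd : ∀ (l : Λ) (x : M l), (∃ n : ℕ, (p ^ n) • x = 0) → (p ^ n₀) • x = 0) :
    ∃ φ : AdicCompletion (Ideal.span {(p : ℤ)}) (⨁ l, M l) →ₗ[ℤ] (∀ l, M l),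
      (∀ x : ⨁ l, M l,
        φ (AdicCompletion.of (Ideal.span {(p : ℤ)}) (⨁ l, M l) x) = fun l => x l) ∧
      (∀ ξ, ∀ n : ℕ,
        AdicCompletion.eval (Ideal.span {(p : ℤ)}) (⨁ l, M l) n ξ = 0 →
        ∀ l, ∃ y : M l, φ ξ l = (p ^ n) • y) ∧
      Function.Injective φ ∧
      Set.range φ = {m : ∀ l, M l |
        ∀ N : ℕ, {l : Λ | ¬ ∃ y : M l, m l = (p ^ N) • y}.Finite} := by
  have hmem (l : Λ) (n : ℕ) (x : M l) :
      x ∈ (Ideal.span {(p : ℤ)} ^ n • ⊤ : Submodule ℤ (M l)) ↔ ∃ y : M l, x = (p ^ n) • y := by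
    rw [Submodule.mem_span_singleton_pow_smul_top_iff]
    simp only [← Nat.cast_pow, natCast_zsmul]
  refine ⟨adicCompletionDirectSumToPi _ M, adicCompletionDirectSumToPi_of _ M, ?_,
    adicCompletionDirectSumToPi_injective _ M, ?_⟩
  · intro ξ n h l
    have := adicCompletionDirectSumToPi_sub_mem _ M (x := 0) h l
    rwa [DirectSum.zero_apply, sub_zero, hmem] at this
  · rw [range_adicCompletionDirectSumToPi]
    simp only [hmem]
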